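/- For every integer t ≥ 2, P(t) ⋆ ( P(9) ∖ {(8,1), (2,1^7), (5,4), (2,2,2,2,1), (4,3,2), (3,3,2,1)} ) = P(t+9). -/

import Mathlib

open scoped Classical

namespace SylowBranching

/-- The cells of the Young diagram of `f` (rows indexed by the first coordinate,
starting from `0`; `f i` is the length of row `i`). -/
def cellsOf (f : ℕ → ℕ) : Set (ℕ × ℕ) := {p | p.2 < f p.1}

/-- `f : ℕ → ℕ` is a partition if it is weakly decreasing with finitely many
nonzero parts.  Its parts are `f 0 ≥ f 1 ≥ ⋯`, and its largest part is `f 0`. -/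
def IsPartition (f : ℕ → ℕ) : Prop :=
  Antitone f ∧ ∃ N, ∀ i, N ≤ i → f i = 0

/-- The size `|f|` of a partition: the number of cells of its Young diagram. -/
noncomputable def psize (f : ℕ → ℕ) : ℕ := (cellsOf f).ncard

/-- `P(n)`: the set of partitions of `n`. -/
def Pset (n : ℕ) : Set (ℕ → ℕ) := {f | IsPartition f ∧ psize f = n}

/-- The conjugate (transpose) partition `f'`. -/
noncomputable def conj (f : ℕ → ℕ) : ℕ → ℕ := fun j => Set.ncard {i | j < f i}

/-- `A° = A ∪ A'`: the closure of a set of partitions under conjugation. -/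
noncomputable def conjClosure (A : Set (ℕ → ℕ)) : Set (ℕ → ℕ) := A ∪ conj '' A

/-- `B_n(t)`: partitions of `n` with largest part at most `t` and at most `t` parts. -/
noncomputable def Bset (n t : ℕ) : Set (ℕ → ℕ) :=
  {f ∈ Pset n | f 0 ≤ t ∧ conj f 0 ≤ t}

/-- The cells of the skew shape `l / m`. -/
def skewCells (l m : ℕ → ℕ) : Set (ℕ × ℕ) :=
  {p | m p.1 ≤ p.2 ∧ p.2 < l p.1}

/-- `d` is read before (or at the same time as) `c` in the reading order of a
filling: right-to-left along rows, rows from top to bottom. -/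
def readBefore (d c : ℕ × ℕ) : Prop :=
  d.1 < c.1 ∨ (d.1 = c.1 ∧ c.2 ≤ d.2)

/-- A Littlewood–Richardson filling of the cell set `γ` of weight `ν`:
all entries are positive; for every `j ≥ 1` there are exactly `ν (j-1)` entries
equal to `j` (i.e. the number of `j`s is the `j`-th part of `ν`); entries weakly
increase along rows and strictly increase down columns; and every initial
segment of the reading word (right-to-left along rows, top to bottom) contains
at least as many entries equal to `j` as entries equal to `j+1`, for all `j ≥ 1`. -/
structure IsLRFilling (γ : Set (ℕ × ℕ)) (ν : ℕ → ℕ) (T : ℕ × ℕ → ℕ) : Prop where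
  pos : ∀ c ∈ γ, 1 ≤ T c
  weight : ∀ j : ℕ, 1 ≤ j → Set.ncard {c ∈ γ | T c = j} = ν (j - 1)
  row_weak : ∀ i j j', (i, j) ∈ γ → (i, j') ∈ γ → j ≤ j' → T (i, j) ≤ T (i, j')
  col_strict : ∀ i i' j, (i, j) ∈ γ → (i', j) ∈ γ → i < i' → T (i, j) < T (i', j)
  lattice : ∀ c ∈ γ, ∀ j : ℕ, 1 ≤ j →
    Set.ncard {d ∈ γ | T d = j + 1 ∧ readBefore d c} ≤
      Set.ncard {d ∈ γ | T d = j ∧ readBefore d c}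

/-- `LR(γ)`: the set of all weights of LR fillings of `γ`. -/
def LRset (γ : Set (ℕ × ℕ)) : Set (ℕ → ℕ) := {ν | ∃ T, IsLRFilling γ ν T}

/-- The Littlewood–Richardson coefficient `c^l_{m ν}`: the number of LR fillings
of the skew shape `l / m` of weight `ν` (zero unless `m ⊆ l`); fillings are
normalised to vanish off the skew shape so that they can be counted. -/
noncomputable def LRcoeff (l m ν : ℕ → ℕ) : ℕ :=
  Set.ncard {T : ℕ × ℕ → ℕ |
    (∀ i, m i ≤ l i) ∧ (∀ c, c ∉ skewCells l m → T c = 0) ∧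
      IsLRFilling (skewCells l m) ν T}

/-- The `⋆` operation on sets of partitions:
`A ⋆ B = {λ : c^λ_{μν} > 0 for some μ ∈ A, ν ∈ B}`. -/
def starOp (A B : Set (ℕ → ℕ)) : Set (ℕ → ℕ) :=
  {l | IsPartition l ∧ ∃ μ ∈ A, ∃ ν ∈ B, 0 < LRcoeff l μ ν}

/-- The partition with the given (weakly decreasing) list of parts. -/
def ofList (L : List ℕ) : ℕ → ℕ := fun i => L.getD i 0

/-- The hook partition `(a, 1^b)`. -/
def hookP (a b : ℕ) : ℕ → ℕ := ofList (a :: List.replicate b 1)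

/-- The partition `(a, μ)` obtained by prepending a first part `a` to `μ`. -/
def consPart (a : ℕ) (μ : ℕ → ℕ) : ℕ → ℕ := fun i => if i = 0 then a else μ (i - 1)

/-- `γ` coincides, up to planar translation, with the Young diagram of `ν`. -/
def TranslateOf (γ : Set (ℕ × ℕ)) (ν : ℕ → ℕ) : Prop :=
  ∃ a b : ℕ, γ = (fun p : ℕ × ℕ => (p.1 + a, p.2 + b)) '' cellsOf ν

/-- `γ` coincides, up to planar translation, with the 180°-rotation of the
Young diagram of `ν`. -/
def RotationOf (γ : Set (ℕ × ℕ)) (ν : ℕ → ℕ) : Prop :=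
  ∃ a b : ℕ, (∀ p ∈ cellsOf ν, p.1 ≤ a ∧ p.2 ≤ b) ∧
    γ = (fun p : ℕ × ℕ => (a - p.1, b - p.2)) '' cellsOf ν

/-- Iterated Littlewood–Richardson coefficients `c^l_{μ^1, …, μ^r}`:
`c^l_{μ} = δ_{l μ}`, and the coefficient for a longer list is obtained by
summing, over partitions `g` of the total size of the remaining factors, the
product of the iterated coefficient of `g` with `c^l_{g μ}`. -/
noncomputable def iterLR : List (ℕ → ℕ) → (ℕ → ℕ) → ℕ
  | [], l => if l = (fun _ => 0 : ℕ → ℕ) then 1 else 0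
  | [μ], l => if l = μ then 1 else 0
  | μ :: μs, l =>
      ∑' g : {g : ℕ → ℕ // IsPartition g ∧ psize g = (μs.map psize).sum},
        iterLR μs g.1 * LRcoeff l g.1 μ

/-- `D(q, m, B)`: partitions `λ` of `qm` with `c^λ_{μ_1, …, μ_q} > 0` for some
`μ_1, …, μ_q ∈ B` that are not all equal. -/
noncomputable def Dset (q m : ℕ) (B : Set (ℕ → ℕ)) : Set (ℕ → ℕ) :=
  {l ∈ Pset (q * m) | ∃ μ : Fin q → (ℕ → ℕ),
    (∀ i, μ i ∈ B) ∧ (∃ i j, μ i ≠ μ j) ∧ 0 < iterLR (List.ofFn μ) l}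

/-- Iterated `⋆` of a list of sets of partitions. -/
def starAll : List (Set (ℕ → ℕ)) → Set (ℕ → ℕ)
  | [] => Pset 0
  | [A] => A
  | A :: B :: rest => starOp A (starAll (B :: rest))

/-- `Ω(φ(1,0,…,0))` for the Sylow 3-subgroup of `S_{3^k}` (`k ≥ 4`):
`B_{3^k}(2a) ∖ {(2a, a−1, 1), (2a, 2, 1^{a−2}), (2a−1, a+1), (2a−1, 1^{a+1})}°`
where `a = 3^{k−1}`. -/
noncomputable def Cset (k : ℕ) : Set (ℕ → ℕ) :=
  Bset (3 ^ k) (2 * 3 ^ (k - 1)) \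
    conjClosure
      {ofList [2 * 3 ^ (k - 1), 3 ^ (k - 1) - 1, 1],
       ofList (2 * 3 ^ (k - 1) :: 2 :: List.replicate (3 ^ (k - 1) - 2) 1),
       ofList [2 * 3 ^ (k - 1) - 1, 3 ^ (k - 1) + 1],
       hookP (2 * 3 ^ (k - 1) - 1) (3 ^ (k - 1) + 1)}

/-- The partitions of `9` removed from the second factor. -/
def excluded : Set (ℕ → ℕ) :=
  {ofList [8, 1], hookP 2 7, ofList [5, 4], ofList [2, 2, 2, 2, 1],
    ofList [4, 3, 2], ofList [3, 3, 2, 1]}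

/-- Some partition `μ ⊆ l` has `|l / μ| = 9` and an LR filling of `l / μ` whose weight is not
one of the excluded partitions. -/
def HasGoodRemoval (l : ℕ → ℕ) : Prop :=
  ∃ μ ν : ℕ → ℕ, ∃ T : ℕ × ℕ → ℕ, IsPartition μ ∧ (∀ i, μ i ≤ l i) ∧
    (skewCells l μ).ncard = 9 ∧ IsLRFilling (skewCells l μ) ν T ∧ ν ∉ excluded

lemma mem_skewCells {l m : ℕ → ℕ} {i j : ℕ} : (i, j) ∈ skewCells l m ↔ m i ≤ j ∧ j < l i :=
  Iff.rfl

lemma IsPartition.finite_skewCells {l : ℕ → ℕ} (hl : IsPartition l) (m : ℕ → ℕ) :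
    (skewCells l m).Finite := by
  obtain ⟨ha, N, hN⟩ := hl
  refine ((Set.finite_Iio N).prod (Set.finite_Iio (l 0))).subset ?_
  rintro ⟨i, j⟩ ⟨-, h⟩
  have h0 := ha (Nat.zero_le i)
  simp only at h
  refine ⟨?_, lt_of_lt_of_le h h0⟩
  by_contra hi
  have := hN i (by simpa using hi)
  omega

lemma cellsOf_eq_skewCells (f : ℕ → ℕ) : cellsOf f = skewCells f 0 := by
  ext ⟨i, j⟩
  simp [cellsOf, skewCells]

lemma psize_eq_add_ncard_skewCells {l m : ℕ → ℕ} (hl : IsPartition l) (hml : ∀ i, m i ≤ l i) :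
    psize l = psize m + (skewCells l m).ncard := by
  have hunion : cellsOf l = cellsOf m ∪ skewCells l m := by
    ext ⟨i, j⟩
    have := hml i
    simp only [cellsOf, skewCells, Set.mem_union, Set.mem_ofPred_eq]
    omega
  have hfin : (cellsOf l).Finite := cellsOf_eq_skewCells l ▸ hl.finite_skewCells 0
  unfold psize
  rw [hunion, Set.ncard_union_eq _ (hfin.subset (hunion ▸ Set.subset_union_left))
    (hl.finite_skewCells m)]
  rw [Set.disjoint_left]
  rintro ⟨i, j⟩ h1 ⟨h2, -⟩
  simp only [cellsOf, Set.mem_ofPred_eq] at h1 h2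
  omega

lemma psize_eq_sum {f : ℕ → ℕ} {N : ℕ} (hN : ∀ i, N ≤ i → f i = 0) :
    psize f = ∑ i ∈ Finset.range N, f i := by
  have hcells : cellsOf f = ↑(((Finset.range N).sigma fun i => Finset.range (f i)).map
      (Equiv.sigmaEquivProd ℕ ℕ).toEmbedding) := by
    ext ⟨i, j⟩
    simp only [cellsOf, Set.mem_ofPred_eq, Finset.coe_map, Set.mem_image, Finset.mem_coe,
      Finset.mem_sigma, Finset.mem_range, Equiv.coe_toEmbedding]
    constructor
    · intro h
      refine ⟨⟨i, j⟩, ⟨?_, h⟩, rfl⟩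
      by_contra hi
      have := hN i (by simpa using hi)
      omega
    · rintro ⟨⟨a, b⟩, ⟨-, h⟩, hab⟩
      simp only [Equiv.sigmaEquivProd_apply, Prod.mk.injEq] at hab
      obtain ⟨rfl, rfl⟩ := hab
      exact h
  rw [psize, hcells, Set.ncard_coe_finset, Finset.card_map, Finset.card_sigma]
  simp

lemma IsPartition.tail {f : ℕ → ℕ} (hf : IsPartition f) : IsPartition fun i => f (i + 1) := by
  obtain ⟨ha, N, hN⟩ := hf
  exact ⟨fun i j h => ha (by omega), N, fun i hi => hN _ (by omega)⟩

lemma IsPartition.psize_eq_head_add {f : ℕ → ℕ} (hf : IsPartition f) :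
    psize f = f 0 + psize fun i => f (i + 1) := by
  obtain ⟨-, N, hN⟩ := hf
  rw [psize_eq_sum (N := N + 1) fun i hi => hN i (by omega),
    psize_eq_sum (N := N) fun i hi => hN _ (by omega), Finset.sum_range_succ', add_comm]

lemma IsLRFilling.weight_succ {γ : Set (ℕ × ℕ)} {ν : ℕ → ℕ} {T : ℕ × ℕ → ℕ}
    (h : IsLRFilling γ ν T) (k : ℕ) : {c ∈ γ | T c = k + 1}.ncard = ν k := by
  simpa using h.weight (k + 1) (by omega)

lemma IsLRFilling.psize_weight {γ : Set (ℕ × ℕ)} {ν : ℕ → ℕ} {T : ℕ × ℕ → ℕ}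
    (h : IsLRFilling γ ν T) (hγ : γ.Finite) : psize ν = γ.ncard := by
  obtain ⟨s, rfl⟩ := hγ.exists_finset_coe
  have hle : ∀ c ∈ s, T c ≤ s.sup T := fun c hc => Finset.le_sup hc
  have hcard : ∀ k, (s.filter fun c => T c = k + 1).card = ν k := by
    intro k
    rw [← h.weight_succ k, ← Set.ncard_coe_finset]
    simp
  rw [psize_eq_sum (N := s.sup T), Set.ncard_coe_finset,
    Finset.card_eq_sum_card_fiberwise (f := fun c => T c - 1) (t := Finset.range (s.sup T))]
  · refine Finset.sum_congr rfl fun k _ => ?_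
    rw [← hcard k]
    congr 1
    refine Finset.filter_congr fun c hc => ?_
    have := h.pos c (by simpa using hc)
    omega
  · intro c hc
    have h1 := h.pos c hc
    have h2 := hle c (by simpa using hc)
    simp only [Finset.coe_range, Set.mem_Iio]
    omega
  · intro i hi
    rw [← hcard i, Finset.card_eq_zero, Finset.filter_eq_empty_iff]
    intro c hc
    have := hle c hc
    omega

lemma exists_read_last {γ : Set (ℕ × ℕ)} (hγ : γ.Finite) (hne : γ.Nonempty) :
    ∃ c ∈ γ, ∀ d ∈ γ, readBefore d c := by
  obtain ⟨c, hc, hmax⟩ := Set.exists_max_image γ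
    (fun p => (toLex (p.1, OrderDual.toDual p.2) : ℕ ×ₗ ℕᵒᵈ)) hγ hne
  refine ⟨c, hc, fun d hd => ?_⟩
  have := hmax d hd
  rw [Prod.Lex.le_iff] at this
  simpa [readBefore] using this

lemma IsLRFilling.isPartition_weight {γ : Set (ℕ × ℕ)} {ν : ℕ → ℕ} {T : ℕ × ℕ → ℕ}
    (h : IsLRFilling γ ν T) (hγ : γ.Finite) : IsPartition ν := by
  constructor
  · refine antitone_nat_of_succ_le fun k => ?_
    rw [← h.weight_succ, ← h.weight_succ]
    rcases γ.eq_empty_or_nonempty with rfl | hne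
    · simp
    obtain ⟨c, hc, hlast⟩ := exists_read_last hγ hne
    have hall : ∀ j, {d ∈ γ | T d = j ∧ readBefore d c} = {d ∈ γ | T d = j} := fun j =>
      Set.ext fun d => ⟨fun hd => ⟨hd.1, hd.2.1⟩, fun hd => ⟨hd.1, hd.2, hlast d hd.1⟩⟩
    simpa only [hall] using h.lattice c hc (k + 1) (by omega)
  · obtain ⟨B, hB⟩ := (hγ.image T).bddAbove
    refine ⟨B, fun i hi => ?_⟩
    rw [← h.weight_succ, Set.ncard_eq_zero (hγ.subset (Set.sep_subset _ _)),
      Set.eq_empty_iff_forall_notMem]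
    rintro c ⟨hc, hTc⟩
    have := hB (Set.mem_image_of_mem T hc)
    omega

lemma IsLRFilling.congr {γ : Set (ℕ × ℕ)} {ν : ℕ → ℕ} {T T' : ℕ × ℕ → ℕ}
    (h : IsLRFilling γ ν T) (hT : ∀ c ∈ γ, T' c = T c) : IsLRFilling γ ν T' where
  pos c hc := hT c hc ▸ h.pos c hc
  weight j hj := by
    rw [← h.weight j hj]
    congr 1
    exact Set.ext fun c => and_congr_right fun hc => by rw [hT c hc]
  row_weak i j j' hj hj' hle := by
    rw [hT _ hj, hT _ hj']
    exact h.row_weak i j j' hj hj' hle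
  col_strict i i' j hi hi' hlt := by
    rw [hT _ hi, hT _ hi']
    exact h.col_strict i i' j hi hi' hlt
  lattice c hc j hj := by
    have hset : ∀ k, {d ∈ γ | T' d = k ∧ readBefore d c} =
        {d ∈ γ | T d = k ∧ readBefore d c} := fun k =>
      Set.ext fun d => and_congr_right fun hd => by rw [hT d hd]
    rw [hset, hset]
    exact h.lattice c hc j hj

lemma LRcoeff_pos {l m ν : ℕ → ℕ} {T : ℕ × ℕ → ℕ} (hl : IsPartition l)
    (hml : ∀ i, m i ≤ l i) (hT : IsLRFilling (skewCells l m) ν T) : 0 < LRcoeff l m ν := by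
  have hγ := hl.finite_skewCells m
  have := hγ.to_subtype
  obtain ⟨-, N, hN⟩ := hT.isPartition_weight hγ
  refine (Set.ncard_pos ?_).2 ⟨fun c => if c ∈ skewCells l m then T c else 0, hml,
    fun c hc => if_neg hc, hT.congr fun c hc => if_pos hc⟩
  refine Set.Finite.of_finite_image (f := fun S (c : skewCells l m) => S c)
    ((Set.Finite.pi' (t := fun _ => Set.Iic N) fun _ => Set.finite_Iic N).subset ?_) ?_
  · rintro _ ⟨S, ⟨-, -, hS⟩, rfl⟩ ⟨c, hc⟩
    by_contra hlt
    simp only [Set.mem_Iic, not_le] at hlt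
    have h0 := hS.weight (S c) (by omega)
    rw [hN _ (by omega), Set.ncard_eq_zero (hγ.subset (Set.sep_subset _ _))] at h0
    exact h0.le ⟨hc, rfl⟩
  · rintro S ⟨-, hS, -⟩ S' ⟨-, hS', -⟩ heq
    funext c
    by_cases hc : c ∈ skewCells l m
    · exact congrFun heq ⟨c, hc⟩
    · rw [hS c hc, hS' c hc]

lemma IsLRFilling.shift {γ : Set (ℕ × ℕ)} {ν : ℕ → ℕ} {T : ℕ × ℕ → ℕ}
    (h : IsLRFilling γ ν T) :
    IsLRFilling (Prod.map Nat.succ id '' γ) ν fun p => T (p.1 - 1, p.2) := by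
  have hinj : Function.Injective (Prod.map Nat.succ (id : ℕ → ℕ)) :=
    Nat.succ_injective.prodMap Function.injective_id
  have hmem : ∀ i j, (i, j) ∈ Prod.map Nat.succ id '' γ → ∃ k, i = k + 1 ∧ (k, j) ∈ γ := by
    rintro i j ⟨⟨k, j'⟩, hk, heq⟩
    simp only [Prod.map_apply, id_eq, Prod.mk.injEq] at heq
    obtain ⟨rfl, rfl⟩ := heq
    exact ⟨k, rfl, hk⟩
  have hsep : ∀ P : ℕ × ℕ → Prop, {c ∈ Prod.map Nat.succ id '' γ | P c} =
      Prod.map Nat.succ id '' {c ∈ γ | P (c.1 + 1, c.2)} := by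
    intro P
    ext c
    constructor
    · rintro ⟨⟨d, hd, rfl⟩, hP⟩
      exact ⟨d, ⟨hd, hP⟩, rfl⟩
    · rintro ⟨d, ⟨hd, hP⟩, rfl⟩
      exact ⟨⟨d, hd, rfl⟩, hP⟩
  constructor
  · rintro _ ⟨d, hd, rfl⟩
    exact h.pos d hd
  · intro j hj
    rw [hsep, Set.ncard_image_of_injective _ hinj]
    exact h.weight j hj
  · intro i j j' hj hj' hle
    obtain ⟨k, rfl, hk⟩ := hmem i j hj
    obtain ⟨k', hkk, hk'⟩ := hmem _ j' hj'
    obtain rfl : k = k' := by omega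
    exact h.row_weak k j j' hk hk' hle
  · intro i i' j hi hi' hlt
    obtain ⟨k, rfl, hk⟩ := hmem i j hi
    obtain ⟨k', rfl, hk'⟩ := hmem i' j hi'
    exact h.col_strict k k' j hk hk' (by omega)
  · rintro _ ⟨c, hc, rfl⟩ j hj
    rw [hsep, hsep, Set.ncard_image_of_injective _ hinj, Set.ncard_image_of_injective _ hinj]
    simpa [readBefore] using h.lattice c hc j hj

lemma HasGoodRemoval.of_tail {l : ℕ → ℕ} (hl : IsPartition l)
    (h : HasGoodRemoval fun i => l (i + 1)) : HasGoodRemoval l := by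
  obtain ⟨μ, ν, T, hμ, hle, hcard, hT, hν⟩ := h
  have hcells : skewCells l (consPart (l 0) μ) =
      Prod.map Nat.succ id '' skewCells (fun i => l (i + 1)) μ := by
    ext ⟨i, j⟩
    cases i with
    | zero =>
      simp [skewCells, consPart]
    | succ i => simp [skewCells, consPart]
  refine ⟨consPart (l 0) μ, ν, _, ?_, ?_, ?_, hcells ▸ hT.shift, hν⟩
  · obtain ⟨ha, N, hN⟩ := hμ
    constructor
    · refine antitone_nat_of_succ_le fun i => ?_
      cases i with
      | zero => simpa [consPart] using (hle 0).trans (hl.1 (Nat.zero_le 1))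
      | succ i => simpa [consPart] using ha (Nat.le_succ i)
    · refine ⟨N + 1, fun i hi => ?_⟩
      rw [consPart, if_neg (by omega)]
      exact hN _ (by omega)
  · intro i
    cases i with
    | zero => simp [consPart]
    | succ i => simpa [consPart] using hle i
  · rw [hcells, Set.ncard_image_of_injective _
      (Nat.succ_injective.prodMap Function.injective_id), hcard]

/-- Filling every column of a skew shape with `1, 2, 3, …` from the top is an LR filling;
`h j` is the height of column `j` of the inner shape. -/
lemma isLRFilling_columns {l m h : ℕ → ℕ} (hl : IsPartition l)
    (hm : ∀ i j, m i ≤ j ↔ h j ≤ i) :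
    IsLRFilling (skewCells l m)
      (fun k => {c ∈ skewCells l m | c.1 + 1 - h c.2 = k + 1}.ncard)
      fun c => c.1 + 1 - h c.2 where
  pos := by
    rintro ⟨i, j⟩ ⟨hc, -⟩
    have := (hm i j).1 hc
    simp only
    omega
  weight j hj := by
    obtain ⟨k, rfl⟩ : ∃ k, j = k + 1 := ⟨j - 1, by omega⟩
    rfl
  row_weak i j j' _ _ hle := by
    have : h j' ≤ h j := (hm _ _).1 (((hm _ _).2 le_rfl).trans hle)
    simp only
    omega
  col_strict i i' j hi _ hlt := by
    have := (hm i j).1 hi.1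
    simp only
    omega
  lattice := by
    rintro ⟨i, j⟩ - k hk
    refine Set.ncard_le_ncard_of_injOn (fun p => (p.1 - 1, p.2)) ?_ ?_
      ((hl.finite_skewCells m).subset (Set.sep_subset _ _))
    · rintro ⟨a, b⟩ ⟨⟨h1, h2⟩, h3, h4⟩
      simp only [readBefore] at h1 h2 h3 h4
      refine ⟨⟨(hm _ _).2 (by simp only; omega), ?_⟩, ?_, ?_⟩
      · exact lt_of_lt_of_le h2 (hl.1 (Nat.sub_le a 1))
      · simp only
        omega
      · simp only [readBefore]
        omega
    · rintro ⟨a, b⟩ ⟨-, h3, -⟩ ⟨a', b'⟩ ⟨-, h3', -⟩ heq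
      simp only [Prod.mk.injEq] at h3 h3' heq ⊢
      omega

/-- The cells of the skew shape with row lengths `L` outside and `M` inside, row by row. -/
def cellList (L M : List ℕ) : List (ℕ × ℕ) :=
  (List.range L.length).flatMap fun i =>
    (List.range' (M.getD i 0) (L.getD i 0 - M.getD i 0)).map (Prod.mk i)

lemma mem_cellList {L M : List ℕ} {c : ℕ × ℕ} :
    c ∈ cellList L M ↔ c ∈ skewCells (ofList L) (ofList M) := by
  obtain ⟨i, j⟩ := c
  simp only [cellList, List.mem_flatMap, List.mem_range, List.mem_map, List.mem_range'_1,
    Prod.mk.injEq, mem_skewCells, ofList]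
  constructor
  · rintro ⟨a, ha, b, hb, rfl, rfl⟩
    omega
  · intro hj
    refine ⟨i, ?_, j, by omega, rfl, rfl⟩
    by_contra hi
    rw [List.getD_eq_default _ _ (by omega : L.length ≤ i)] at hj
    omega

lemma nodup_cellList (L M : List ℕ) : (cellList L M).Nodup := by
  refine List.nodup_flatMap.2 ⟨fun i _ => ?_, ?_⟩
  · exact List.Nodup.map (Prod.mk_right_injective i) List.nodup_range'
  · refine List.nodup_range.imp fun {a b} hab => ?_
    simp only [Function.onFun, List.disjoint_left, List.mem_map]
    rintro _ ⟨x, -, rfl⟩ ⟨y, -, hy⟩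
    exact hab (Prod.mk.inj hy).1.symm

lemma ncard_sep_skewCells (L M : List ℕ) (P : ℕ × ℕ → Prop) [DecidablePred P] :
    {c ∈ skewCells (ofList L) (ofList M) | P c}.ncard = (cellList L M).countP (P ·) := by
  have hset : {c ∈ skewCells (ofList L) (ofList M) | P c} =
      ↑((cellList L M).filter (P ·)).toFinset := by
    ext c
    simp [mem_cellList]
  rw [hset, Set.ncard_coe_finset, List.toFinset_card_of_nodup ((nodup_cellList L M).filter _),
    List.countP_eq_length_filter]

lemma hasGoodRemoval_of_long_first_row {l : ℕ → ℕ} (hl : IsPartition l) (h : l 1 + 9 ≤ l 0) :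
    HasGoodRemoval l := by
  have hcells : skewCells l (fun i => if i = 0 then l 0 - 9 else l i) =
      Prod.mk 0 '' Set.Ico (l 0 - 9) (l 0) := by
    ext ⟨i, j⟩
    simp only [mem_skewCells, Set.mem_image, Set.mem_Ico, Prod.mk.injEq]
    constructor
    · rintro ⟨h1, h2⟩
      split_ifs at h1 with hi
      · subst hi
        exact ⟨j, ⟨h1, h2⟩, rfl, rfl⟩
      · omega
    · rintro ⟨_, hj, rfl, rfl⟩
      simpa using hj
  have hcard : (Prod.mk 0 '' Set.Ico (l 0 - 9) (l 0)).ncard = 9 := by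
    rw [Set.ncard_image_of_injective _ (Prod.mk_right_injective 0), ← Finset.coe_Ico,
      Set.ncard_coe_finset, Nat.card_Ico]
    omega
  have hfill : IsLRFilling (Prod.mk 0 '' Set.Ico (l 0 - 9) (l 0))
      (fun k => if k = 0 then 9 else 0) fun _ => 1 := by
    refine ⟨fun _ _ => le_rfl, ?_, fun _ _ _ _ _ _ => le_rfl, ?_, ?_⟩
    · intro j hj
      rcases eq_or_ne j 1 with rfl | hj1
      · exact (congrArg Set.ncard (Set.sep_eq_self_iff_mem_true.2 fun _ _ => rfl)).trans hcard
      · rw [if_neg (by omega)]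
        simp [hj1.symm]
    · rintro i i' j ⟨_, _, hi⟩ ⟨_, _, hi'⟩ hlt
      simp only [Prod.mk.injEq] at hi hi'
      omega
    · intro c _ j hj
      have : j ≠ 0 := by omega
      simp [this]
  refine ⟨_, _, _, ⟨?_, ?_⟩, ?_, hcells ▸ hcard, hcells ▸ hfill, ?_⟩
  · refine antitone_nat_of_succ_le fun i => ?_
    cases i with
    | zero => simpa using (by omega : l 1 ≤ l 0 - 9)
    | succ i => simpa using hl.1 (Nat.le_succ (i + 1))
  · obtain ⟨-, N, hN⟩ := hl
    refine ⟨N + 1, fun i hi => ?_⟩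
    rw [if_neg (by omega)]
    exact hN i (by omega)
  · intro i
    split_ifs with hi
    · subst hi
      omega
    · exact le_rfl
  · simp only [excluded, Set.mem_insert_iff, Set.mem_singleton_iff, not_or]
    refine ⟨?_, ?_, ?_, ?_, ?_, ?_⟩ <;> intro heq <;> simpa [ofList, hookP] using congrFun heq 0

/-- The first four parts of the excluded partitions. -/
def excludedFirstParts : List (List ℕ) :=
  [[8, 1, 0, 0], [2, 1, 1, 1], [5, 4, 0, 0], [2, 2, 2, 2], [4, 3, 2, 0], [3, 3, 2, 1]]

lemma firstParts_mem_of_mem_excluded {ν : ℕ → ℕ} (h : ν ∈ excluded) :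
    [ν 0, ν 1, ν 2, ν 3] ∈ excludedFirstParts := by
  simp only [excluded, Set.mem_insert_iff, Set.mem_singleton_iff] at h
  rcases h with rfl | rfl | rfl | rfl | rfl | rfl <;> decide

/-- `M` lists the row lengths of a partition obtained from `L` by removing nine cells, and the
filling `T` of the removed cells has a weight outside the excluded set. -/
def removalCheck (L M : List ℕ) (T : ℕ × ℕ → ℕ) : Bool :=
  decide (M.Pairwise (· ≥ ·)) && decide (M.length ≤ L.length) &&
    (List.range L.length).all (fun i => M.getD i 0 ≤ L.getD i 0) &&
    (cellList L M).length == 9 &&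
    !excludedFirstParts.contains
      ([1, 2, 3, 4].map fun k => (cellList L M).countP fun c => T c = k)

lemma isPartition_ofList {M : List ℕ} (h : M.Pairwise (· ≥ ·)) : IsPartition (ofList M) := by
  refine ⟨fun i j hij => ?_, M.length, fun i hi => List.getD_eq_default _ _ hi⟩
  unfold ofList
  rcases lt_or_ge j M.length with hj | hj
  · rw [List.getD_eq_getElem _ _ hj, List.getD_eq_getElem _ _ (hij.trans_lt hj)]
    rcases hij.eq_or_lt with rfl | hlt
    · exact le_rfl
    · exact List.pairwise_iff_getElem.1 h i j _ hj hlt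
  · rw [List.getD_eq_default _ _ hj]
    exact Nat.zero_le _

lemma hasGoodRemoval_of_removalCheck {L M : List ℕ} {T : ℕ × ℕ → ℕ} {ν : ℕ → ℕ}
    (h : removalCheck L M T = true)
    (hT : IsLRFilling (skewCells (ofList L) (ofList M)) ν T) : HasGoodRemoval (ofList L) := by
  simp only [removalCheck, Bool.and_eq_true, decide_eq_true_eq, List.all_eq_true, List.mem_range,
    beq_iff_eq, Bool.not_eq_true', List.contains_eq_mem, decide_eq_false_iff_not] at h
  obtain ⟨⟨⟨⟨hsorted, hlen⟩, hle⟩, hcard⟩, hparts⟩ := h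
  refine ⟨ofList M, ν, T, isPartition_ofList hsorted, fun i => ?_, ?_, hT, fun hν => hparts ?_⟩
  · rcases lt_or_ge i L.length with hi | hi
    · exact hle i hi
    · exact (List.getD_eq_default _ _ (hlen.trans hi)).trans_le (Nat.zero_le _)
  · have := ncard_sep_skewCells L M fun _ => True
    simpa [hcard] using this
  · convert firstParts_mem_of_mem_excluded hν using 1
    simp only [← hT.weight_succ, ncard_sep_skewCells]
    rfl

/-- The entry of the cell `c` when every column of a skew shape with inner rows `M` is filled
with `1, 2, 3, …` from the top. -/
def columnEntry (M : List ℕ) (c : ℕ × ℕ) : ℕ := c.1 + 1 - M.countP (c.2 < ·)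

lemma ofList_le_iff {M : List ℕ} (h : M.Pairwise (· ≥ ·)) (i j : ℕ) :
    ofList M i ≤ j ↔ M.countP (j < ·) ≤ i := by
  induction M generalizing i with
  | nil => simp [ofList]
  | cons a M ih =>
    obtain ⟨ha, hM⟩ := List.pairwise_cons.1 h
    rcases lt_or_ge j a with hja | hja
    · rw [List.countP_cons_of_pos (by simpa using hja)]
      cases i with
      | zero => simpa [ofList] using hja
      | succ i => simpa [ofList] using ih hM i
    · have hzero : (a :: M).countP (j < ·) = 0 := by
        simp only [List.countP_eq_zero, List.mem_cons, decide_eq_true_eq, not_lt]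
        rintro b (rfl | hb)
        · exact hja
        · exact (ha b hb).trans hja
      have hle : ofList (a :: M) i ≤ a := (isPartition_ofList h).1 (Nat.zero_le i)
      simp only [hzero, Nat.zero_le, iff_true]
      exact hle.trans hja

lemma hasGoodRemoval_of_columns {L M : List ℕ} (hL : IsPartition (ofList L))
    (h : removalCheck L M (columnEntry M) = true) : HasGoodRemoval (ofList L) := by
  have hsorted : M.Pairwise (· ≥ ·) := by
    simp only [removalCheck, Bool.and_eq_true, decide_eq_true_eq] at h
    exact h.1.1.1.1
  exact hasGoodRemoval_of_removalCheck h (isLRFilling_columns hL (ofList_le_iff hsorted))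

instance (d c : ℕ × ℕ) : Decidable (readBefore d c) :=
  inferInstanceAs (Decidable (d.1 < c.1 ∨ (d.1 = c.1 ∧ c.2 ≤ d.2)))

/-- The conditions on an LR filling with entries at most `9`, checked on the listed cells. -/
def fillingCheck (C : List (ℕ × ℕ)) (T : ℕ × ℕ → ℕ) : Bool :=
  C.all fun c => decide (1 ≤ T c) && decide (T c ≤ 9) &&
    C.all (fun d => (c.1 = d.1 → c.2 ≤ d.2 → T c ≤ T d) ∧
      (c.2 = d.2 → c.1 < d.1 → T c < T d)) &&
    (List.range 8).all fun k => C.countP (fun d => T d = k + 1 + 1 ∧ readBefore d c) ≤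
      C.countP fun d => T d = k + 1 ∧ readBefore d c

lemma isLRFilling_of_fillingCheck {L M : List ℕ} {T : ℕ × ℕ → ℕ}
    (h : fillingCheck (cellList L M) T = true) :
    IsLRFilling (skewCells (ofList L) (ofList M))
      (fun k => {c ∈ skewCells (ofList L) (ofList M) | T c = k + 1}.ncard) T := by
  simp only [fillingCheck, List.all_eq_true, Bool.and_eq_true, decide_eq_true_eq, mem_cellList,
    List.mem_range] at h
  constructor
  · exact fun c hc => (h c hc).1.1.1
  · intro j hj
    obtain ⟨k, rfl⟩ : ∃ k, j = k + 1 := ⟨j - 1, by omega⟩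
    rfl
  · exact fun i j j' hj hj' hle => ((h _ hj).1.2 _ hj').1 rfl hle
  · exact fun i i' j hi hi' hlt => ((h _ hi).1.2 _ hi').2 rfl hlt
  · intro c hc j hj
    obtain ⟨k, rfl⟩ : ∃ k, j = k + 1 := ⟨j - 1, by omega⟩
    rcases lt_or_ge k 8 with hk | hk
    · simpa only [ncard_sep_skewCells] using (h c hc).2 k hk
    · have hempty : {d ∈ skewCells (ofList L) (ofList M) |
          T d = k + 1 + 1 ∧ readBefore d c} = ∅ := by
        rw [Set.eq_empty_iff_forall_notMem]
        rintro d ⟨hd, hTd, -⟩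
        have := (h d hd).1.1.2
        omega
      simp [hempty]

/-- LR tableaux of skew shapes with nine cells, given row by row with `0` marking the cells of
the inner shape. -/
def sporadicTableaux : List (List (List ℕ)) :=
  [[[0, 0, 1, 1, 1, 1, 1, 1], [1, 2], [2]],
    [[0, 0, 1, 1, 1], [1, 1, 2, 2, 2], [3]],
    [[0, 0, 1, 1], [1, 1, 2], [2, 2, 3], [4]],
    [[0, 0, 1], [1, 1, 2], [2, 3], [3, 4], [4]],
    [[0, 1], [0, 2], [1, 3], [2, 4], [3, 5], [6]],
    [[0, 0], [0, 1], [1, 2], [2, 3], [3, 4], [5], [6]]]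

/-- The entry of the cell `c` in the tableau with rows `E`. -/
def tableauEntry (E : List (List ℕ)) (c : ℕ × ℕ) : ℕ := (E.getD c.1 []).getD c.2 0

lemma hasGoodRemoval_of_sporadic {E : List (List ℕ)} (hE : E ∈ sporadicTableaux) :
    HasGoodRemoval (ofList (E.map List.length)) := by
  have hcheck : ∀ E ∈ sporadicTableaux,
      removalCheck (E.map List.length) (E.map (List.count 0)) (tableauEntry E) = true ∧
      fillingCheck (cellList (E.map List.length) (E.map (List.count 0))) (tableauEntry E) =
        true := by
    decide +kernel
  obtain ⟨h1, h2⟩ := hcheck E hE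
  exact hasGoodRemoval_of_removalCheck h1 (isLRFilling_of_fillingCheck h2)

/-- Lists of row lengths of the partitions of size at most `s` with parts at most `m`;
correct as soon as `s ≤ n`. -/
def partitionLists : ℕ → ℕ → ℕ → List (List ℕ)
  | 0, _, _ => [[]]
  | n + 1, m, s => [] :: (List.range (min m s)).flatMap fun a =>
      (partitionLists n (a + 1) (s - (a + 1))).map (List.cons (a + 1))

lemma IsPartition.eq_ofList_nil {f : ℕ → ℕ} (hf : IsPartition f) (h0 : f 0 = 0) :
    f = ofList [] := by
  funext i
  have := hf.1 (Nat.zero_le i)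
  simp only [ofList, List.getD_nil]
  omega

lemma eq_ofList_cons {f : ℕ → ℕ} {R : List ℕ} (hR : (fun i => f (i + 1)) = ofList R) :
    f = ofList (f 0 :: R) := by
  funext i
  cases i with
  | zero => rfl
  | succ i => exact congrFun hR i

lemma IsPartition.exists_mem_partitionLists {f : ℕ → ℕ} (hf : IsPartition f) {n m s : ℕ}
    (hsn : s ≤ n) (hm : f 0 ≤ m) (hs : psize f ≤ s) :
    ∃ R ∈ partitionLists n m s, f = ofList R := by
  induction n generalizing f m s with
  | zero =>
    have := hf.psize_eq_head_add
    exact ⟨[], by simp [partitionLists], hf.eq_ofList_nil (by omega)⟩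
  | succ n ih =>
    have hsize := hf.psize_eq_head_add
    rcases Nat.eq_zero_or_pos (f 0) with h0 | hpos
    · exact ⟨[], by simp [partitionLists], hf.eq_ofList_nil h0⟩
    · obtain ⟨R, hR, hfR⟩ := ih hf.tail (m := f 0) (s := s - f 0) (by omega)
        (hf.1 (Nat.zero_le 1)) (by omega)
      refine ⟨f 0 :: R, ?_, eq_ofList_cons hfR⟩
      simp only [partitionLists, List.mem_cons, reduceCtorEq, false_or, List.mem_flatMap,
        List.mem_range, List.mem_map]
      refine ⟨f 0 - 1, by omega, R, ?_, ?_⟩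
      · rwa [Nat.sub_add_cancel hpos]
      · rw [Nat.sub_add_cancel hpos]

/-- Lists of row lengths at most `m` obtained by removing `d` cells from the rows `L`. -/
def removals : List ℕ → ℕ → ℕ → List (List ℕ)
  | [], _, d => if d = 0 then [[]] else []
  | a :: L, m, d => if a + L.sum < d then [] else
      (List.range (min a d + 1)).flatMap fun r =>
        if a - r ≤ m then (removals L (a - r) (d - r)).map (List.cons (a - r)) else []

lemma exists_removal_or_sporadic : ∀ R ∈ partitionLists 10 10 10, ∀ g ∈ List.range 9,
    (11 ≤ R.headD 0 + g + R.sum →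
      ((removals ((R.headD 0 + g) :: R) (R.headD 0 + g) 9).any fun M =>
        removalCheck ((R.headD 0 + g) :: R) M (columnEntry M)) = true ∨
      ∃ E ∈ sporadicTableaux, E.map List.length = (R.headD 0 + g) :: R) := by
  decide +kernel

lemma psize_ofList (L : List ℕ) : psize (ofList L) = L.sum := by
  rw [psize_eq_sum (f := ofList L) (N := L.length) fun i hi => List.getD_eq_default _ _ hi,
    Finset.sum_range, ← Fin.sum_univ_getElem]
  exact Finset.sum_congr rfl fun i _ => List.getD_eq_getElem _ _ i.2

lemma IsPartition.hasGoodRemoval {l : ℕ → ℕ} (hl : IsPartition l) (h : 11 ≤ psize l) :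
    HasGoodRemoval l := by
  obtain ⟨N, hN⟩ := hl.2
  induction N generalizing l with
  | zero =>
    rw [psize_eq_sum hN] at h
    simp at h
  | succ N ih =>
    rcases le_or_gt 11 (psize fun i => l (i + 1)) with ht | ht
    · exact .of_tail hl (ih hl.tail ht fun i hi => hN _ (by omega))
    rcases le_or_gt (l 1 + 9) (l 0) with hlong | hshort
    · exact hasGoodRemoval_of_long_first_row hl hlong
    have htail := hl.tail.psize_eq_head_add
    simp only [zero_add] at htail
    obtain ⟨R, hR, hlR⟩ := hl.tail.exists_mem_partitionLists (n := 10) (m := 10) (s := 10) le_rfl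
      (by rw [zero_add]; omega) (by omega)
    have hhead : l 1 = R.headD 0 := by
      rw [show l 1 = ofList R 0 from congrFun hlR 0]
      cases R <;> rfl
    have hmono : l 1 ≤ l 0 := hl.1 (Nat.zero_le 1)
    have hl0 : R.headD 0 + (l 0 - l 1) = l 0 := by omega
    have hlist : l = ofList (l 0 :: R) := eq_ofList_cons hlR
    have hsum : psize l = l 0 + R.sum := by
      rw [hl.psize_eq_head_add, hlR, psize_ofList]
    have key := exists_removal_or_sporadic R hR (l 0 - l 1)
      (List.mem_range.2 (by omega))
    rw [hl0] at key
    rcases key (by omega) with hM | ⟨E, hE, hEL⟩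
    · obtain ⟨M, -, hM⟩ := List.any_eq_true.1 hM
      rw [hlist]
      exact hasGoodRemoval_of_columns (hlist ▸ hl) hM
    · rw [hlist, ← hEL]
      exact hasGoodRemoval_of_sporadic hE

/-- for every `t ≥ 2`,
`P(t) ⋆ (P(9) ∖ {(8,1), (2,1^7), (5,4), (2,2,2,2,1), (4,3,2), (3,3,2,1)}) = P(t+9)`. -/
theorem star_omega_nine (t : ℕ) (ht : 2 ≤ t) :
    starOp (Pset t)
        (Pset 9 \
          {ofList [8, 1], hookP 2 7, ofList [5, 4], ofList [2, 2, 2, 2, 1],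
            ofList [4, 3, 2], ofList [3, 3, 2, 1]}) =
      Pset (t + 9) := by
  ext l
  constructor
  · rintro ⟨hl, μ, ⟨-, hμ⟩, ν, ⟨⟨-, hν⟩, -⟩, hpos⟩
    obtain ⟨T, hle, -, hT⟩ := Set.nonempty_of_ncard_ne_zero hpos.ne'
    refine ⟨hl, ?_⟩
    rw [psize_eq_add_ncard_skewCells hl hle, hμ, ← hT.psize_weight (hl.finite_skewCells μ), hν]
  · rintro ⟨hl, hsize⟩
    obtain ⟨μ, ν, T, hμ, hle, hcard, hT, hν⟩ := hl.hasGoodRemoval (by omega)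
    have hγ := hl.finite_skewCells μ
    refine ⟨hl, μ, ⟨hμ, ?_⟩, ν, ⟨⟨hT.isPartition_weight hγ, ?_⟩, hν⟩, LRcoeff_pos hl hle hT⟩
    · have := psize_eq_add_ncard_skewCells hl hle
      omega
    · rw [hT.psize_weight hγ, hcard]

end SylowBranching
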